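/- arXiv:1104.1024 — 2 statements merged into one kernel-verified Lean document; each statement's English description precedes it below -/
import Mathlib

section
/- Assume the base graph G is connected (and bipartite with at least one edge). Let X and Y be independent, uniformly distributed random vertices of G_n. Then the expected graph distance between X and Y in G_n satisfies (4 n₁ n₂ / N²)·(n − 1) < E[dist_{G_n}(X,Y)] < N + (4 n₁ n₂ / N²)·(n − 1). In particular the average shortest-path length in G_n is of order log(|V(G_n)|). -/
noncomputable section
attribute [local instance] Classical.propDecidable

namespace HierGraph

open Finset MeasureTheory ProbabilityTheory

variable {N : ℕ}

/-- The degree of a vertex in a finite simple graph. -/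
def degH {α : Type*} [Fintype α] (H : SimpleGraph α) (v : α) : ℕ :=
  (univ.filter fun w => H.Adj v w).card

/-- The length `|x ∧ y|` of the longest common prefix of two words. -/
def prefixLen {n : ℕ} (x y : Fin n → Fin N) : ℕ :=
  (univ.filter fun i : Fin n => ∀ j : Fin n, j ≤ i → x j = y j).card

/-- The postfix of `x` starting at position `k` has constant type
(`t = true` ↔ all its letters lie in `V1`). -/
def postfixType (V1 : Finset (Fin N)) {n : ℕ} (k : ℕ) (x : Fin n → Fin N) (t : Bool) : Prop :=
  ∀ i : Fin n, k ≤ i.val → (x i ∈ V1 ↔ t = true)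

/-- The edge relation of the graph `Gₙ` (loops included): `x = y`, or the two postfixes
after the common prefix have types `{1,2}` and corresponding letters are adjacent in `G`. -/
def EdgeRel (G : SimpleGraph (Fin N)) (V1 : Finset (Fin N)) {n : ℕ} (x y : Fin n → Fin N) :
    Prop :=
  x = y ∨
    ((∃ t : Bool, postfixType V1 (prefixLen x y) x t ∧ postfixType V1 (prefixLen x y) y (!t)) ∧
      ∀ i : Fin n, prefixLen x y ≤ i.val → G.Adj (x i) (y i))

/-- The degree of a vertex of `Gₙ`, the loop counting `2`. -/
def degGn (G : SimpleGraph (Fin N)) (V1 : Finset (Fin N)) {n : ℕ} (x : Fin n → Fin N) : ℕ :=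
  2 + (univ.filter fun y : Fin n → Fin N => y ≠ x ∧ EdgeRel G V1 x y).card

/-- `ℓ(x)`: the length of the longest suffix of `x` of constant (nonzero) type. -/
def ell (V1 : Finset (Fin N)) {n : ℕ} (x : Fin n → Fin N) : ℕ :=
  ((Finset.Icc 1 n).filter fun i =>
    (∀ j : Fin n, n - i ≤ j.val → x j ∈ V1) ∨ ∀ j : Fin n, n - i ≤ j.val → x j ∉ V1).sup id

/-- `S(x) = Σ_{r=0}^{ℓ(x)-1} Π_{j=1}^{r} deg(x_{n-j})`. -/
def Sx (G : SimpleGraph (Fin N)) (V1 : Finset (Fin N)) {n : ℕ} (hn : 0 < n)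
    (x : Fin n → Fin N) : ℕ :=
  ∑ r ∈ Finset.range (ell V1 x), ∏ j ∈ Finset.Icc 1 r, degH G (x ⟨n - 1 - j, by omega⟩)

/-- The simple graph `Gₙ` (loops removed). -/
def GnSimple (G : SimpleGraph (Fin N)) (V1 : Finset (Fin N)) (n : ℕ) :
    SimpleGraph (Fin n → Fin N) :=
  SimpleGraph.fromRel (EdgeRel G V1)

/-- The diameter of a finite graph: the maximal graph distance. -/
def fdiam {α : Type*} [Fintype α] (H : SimpleGraph α) : ℕ :=
  univ.sup fun p : α × α => H.dist p.1 p.2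

/-- The number of maximal constant-type blocks of the postfix of `x` starting at
position `k` (`k < n`). -/
def blockCount (V1 : Finset (Fin N)) {n : ℕ} (k : ℕ) (x : Fin n → Fin N) : ℕ :=
  1 + (univ.filter fun i : Fin n =>
        k ≤ i.val ∧ ∃ h : i.val + 1 < n, ¬((x i ∈ V1) ↔ x ⟨i.val + 1, h⟩ ∈ V1)).card

/-- The left endpoint of the `N`-adic interval `I_x`. -/
def Ipt {n : ℕ} (x : Fin n → Fin N) : ℝ := ∑ r : Fin n, (x r : ℝ) / (N : ℝ) ^ (r.val + 1)

/-- The `N`-adic interval `I_x ⊆ [0,1]`. -/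
def Iset {n : ℕ} (x : Fin n → Fin N) : Set ℝ := Set.Icc (Ipt x) (Ipt x + 1 / (N : ℝ) ^ n)

/-- The level-`n` square `Q_{(x,y)} = I_x × I_y`. -/
def Qset {n : ℕ} (x y : Fin n → Fin N) : Set (ℝ × ℝ) := Iset x ×ˢ Iset y

/-- `Λₙ`: the embedded adjacency matrix of `Gₙ` in the unit square. -/
def Lam (G : SimpleGraph (Fin N)) (V1 : Finset (Fin N)) (n : ℕ) : Set (ℝ × ℝ) :=
  ⋃ (p : (Fin n → Fin N) × (Fin n → Fin N)) (_ : EdgeRel G V1 p.1 p.2), Qset p.1 p.2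

/-- `Λ = ⋂_{n ≥ 1} Λₙ`. -/
def LamInf (G : SimpleGraph (Fin N)) (V1 : Finset (Fin N)) : Set (ℝ × ℝ) :=
  ⋂ (n : ℕ) (_ : 1 ≤ n), Lam G V1 n

/-- The homothety `f_v(a,b) = ((a,b) + v)/N` for `v ∈ Σ₁ × Σ₁`. -/
def fmap (N : ℕ) (v : Fin N × Fin N) : ℝ × ℝ → ℝ × ℝ :=
  fun p => ((p.1 + (v.1 : ℝ)) / N, (p.2 + (v.2 : ℝ)) / N)

/-- `f_v = f_{v₁} ∘ ⋯ ∘ f_{vₙ}` for a word `v` over `Σ₁ × Σ₁` (identity for the empty word). -/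
def fpath {n : ℕ} (v : Fin n → Fin N × Fin N) : ℝ × ℝ → ℝ × ℝ :=
  (List.ofFn fun i => fmap N (v i)).foldr (· ∘ ·) id

/-- The unit square `[0,1]²`. -/
def unitSq : Set (ℝ × ℝ) := Set.Icc (0 : ℝ) 1 ×ˢ Set.Icc (0 : ℝ) 1

/-- The diagonal `{(t,t) : t ∈ [0,1]}`. -/
def DiagSet : Set (ℝ × ℝ) := (fun t : ℝ => (t, t)) '' Set.Icc (0 : ℝ) 1

/-- `V_dd`, the diagonal vertices of the directed graph `𝒢`. -/
def Vdd (v : Fin N × Fin N) : Prop := v.1 = v.2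

/-- `V₁₂`, vertices of `𝒢` coming from edges of `G` directed from `V₁` to `V₂`. -/
def V12 (G : SimpleGraph (Fin N)) (V1 : Finset (Fin N)) (v : Fin N × Fin N) : Prop :=
  v.1 ∈ V1 ∧ v.2 ∉ V1 ∧ G.Adj v.1 v.2

/-- `V₂₁`, vertices of `𝒢` coming from edges of `G` directed from `V₂` to `V₁`. -/
def V21 (G : SimpleGraph (Fin N)) (V1 : Finset (Fin N)) (v : Fin N × Fin N) : Prop :=
  v.1 ∉ V1 ∧ v.2 ∈ V1 ∧ G.Adj v.1 v.2

/-- Vertices of the directed graph `𝒢`. -/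
def calGVert (G : SimpleGraph (Fin N)) (V1 : Finset (Fin N)) (v : Fin N × Fin N) : Prop :=
  Vdd v ∨ V12 G V1 v ∨ V21 G V1 v

/-- Directed edges of `𝒢`: all pairs (loops included) within each of `V_dd`, `V₁₂`, `V₂₁`,
plus one edge from each vertex of `V_dd` to each vertex of `V₁₂ ∪ V₂₁`. -/
def calGEdge (G : SimpleGraph (Fin N)) (V1 : Finset (Fin N)) (u v : Fin N × Fin N) : Prop :=
  (Vdd u ∧ Vdd v) ∨ (V12 G V1 u ∧ V12 G V1 v) ∨ (V21 G V1 u ∧ V21 G V1 v) ∨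
    (Vdd u ∧ (V12 G V1 v ∨ V21 G V1 v))

/-- `v ∈ 𝒫ₙ`: `v` is a directed path of length `n` in `𝒢`. -/
def IsPathCalG (G : SimpleGraph (Fin N)) (V1 : Finset (Fin N)) {n : ℕ}
    (v : Fin n → Fin N × Fin N) : Prop :=
  (∀ i, calGVert G V1 (v i)) ∧
    ∀ i j : Fin n, (j : ℕ) = (i : ℕ) + 1 → calGEdge G V1 (v i) (v j)

/-- Non-loop edges of `Gₙ`, i.e. edges of `G'ₙ`. -/
def GnEdge' (G : SimpleGraph (Fin N)) (V1 : Finset (Fin N)) {n : ℕ} (x y : Fin n → Fin N) :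
    Prop :=
  x ≠ y ∧ EdgeRel G V1 x y

/-- The extra edges `RE(Ĝₙ)`: the two words agree except in the last letter, and the last
letters form an extra edge (an edge of `R`). -/
def REn (R : SimpleGraph (Fin N)) {n : ℕ} (x y : Fin n → Fin N) : Prop :=
  ∃ h : 0 < n, (∀ i : Fin n, i.val + 1 < n → x i = y i) ∧
    R.Adj (x ⟨n - 1, Nat.sub_lt h Nat.one_pos⟩) (y ⟨n - 1, Nat.sub_lt h Nat.one_pos⟩)

/-- Adjacency in `Ĝₙ`. -/
def hatAdj (G R : SimpleGraph (Fin N)) (V1 : Finset (Fin N)) {n : ℕ} (x y : Fin n → Fin N) :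
    Prop :=
  GnEdge' G V1 x y ∨ REn R x y

/-- The graph `Ĝₙ`. -/
def HatGn (G R : SimpleGraph (Fin N)) (V1 : Finset (Fin N)) (n : ℕ) :
    SimpleGraph (Fin n → Fin N) :=
  SimpleGraph.fromRel (hatAdj G R V1)

/-- Property R: every `x ∈ Σ₁` lies in a triangle having two edges in `E(G)` and
one extra edge (an edge of `R`). -/
def PropertyR (G R : SimpleGraph (Fin N)) : Prop :=
  ∀ x : Fin N, ∃ y z : Fin N,
    (G.Adj x y ∧ G.Adj x z ∧ R.Adj y z) ∨ (G.Adj x y ∧ R.Adj x z ∧ G.Adj y z) ∨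
      (R.Adj x y ∧ G.Adj x z ∧ G.Adj y z)

/-- Exactly two of the three edges of the triangle `(x,y,z)` are non-loop edges of `Gₙ`. -/
def exactlyTwoG (G : SimpleGraph (Fin N)) (V1 : Finset (Fin N)) {n : ℕ}
    (x y z : Fin n → Fin N) : Prop :=
  (GnEdge' G V1 x y ∧ GnEdge' G V1 x z ∧ ¬GnEdge' G V1 y z) ∨
    (GnEdge' G V1 x y ∧ ¬GnEdge' G V1 x z ∧ GnEdge' G V1 y z) ∨
      (¬GnEdge' G V1 x y ∧ GnEdge' G V1 x z ∧ GnEdge' G V1 y z)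

/-- `Δₙ¹(x)` (counted over ordered pairs): class-1 regular triangles at `x` in `Ĝₙ`. -/
def numTri1 (G R : SimpleGraph (Fin N)) (V1 : Finset (Fin N)) {n : ℕ} (x : Fin n → Fin N) :
    ℕ :=
  (univ.filter fun p : (Fin n → Fin N) × (Fin n → Fin N) =>
    GnEdge' G V1 x p.1 ∧ GnEdge' G V1 x p.2 ∧ REn R p.1 p.2).card

/-- `Δₙ²(x)` (counted over ordered pairs): class-2 regular triangles at `x` in `Ĝₙ`. -/
def numTri2 (G R : SimpleGraph (Fin N)) (V1 : Finset (Fin N)) {n : ℕ} (x : Fin n → Fin N) :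
    ℕ :=
  (univ.filter fun p : (Fin n → Fin N) × (Fin n → Fin N) =>
    GnEdge' G V1 x p.1 ∧ REn R x p.2 ∧ GnEdge' G V1 p.1 p.2).card

/-- `Δₙ^{ir}(x)` (counted over ordered pairs): irregular triangles at `x` in `Ĝₙ`. -/
def numTriIr (G R : SimpleGraph (Fin N)) (V1 : Finset (Fin N)) {n : ℕ} (x : Fin n → Fin N) :
    ℕ :=
  (univ.filter fun p : (Fin n → Fin N) × (Fin n → Fin N) =>
    hatAdj G R V1 x p.1 ∧ hatAdj G R V1 x p.2 ∧ hatAdj G R V1 p.1 p.2 ∧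
      ¬exactlyTwoG G V1 x p.1 p.2).card

/-- Exactly two of the three edges of the triangle `(x,y,z)` are edges of `G`. -/
def exactlyTwoB (G : SimpleGraph (Fin N)) (x y z : Fin N) : Prop :=
  (G.Adj x y ∧ G.Adj x z ∧ ¬G.Adj y z) ∨ (G.Adj x y ∧ ¬G.Adj x z ∧ G.Adj y z) ∨
    (¬G.Adj x y ∧ G.Adj x z ∧ G.Adj y z)

/-- `Δ¹(z)` (counted over ordered pairs): class-1 regular triangles at `z` in `Ĝ = G ⊔ R`. -/
def numTri1B (G R : SimpleGraph (Fin N)) (z : Fin N) : ℕ :=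
  (univ.filter fun p : Fin N × Fin N => G.Adj z p.1 ∧ G.Adj z p.2 ∧ R.Adj p.1 p.2).card

/-- `Δ²(z)` (counted over ordered pairs): class-2 regular triangles at `z` in `Ĝ = G ⊔ R`. -/
def numTri2B (G R : SimpleGraph (Fin N)) (z : Fin N) : ℕ :=
  (univ.filter fun p : Fin N × Fin N => G.Adj z p.1 ∧ R.Adj z p.2 ∧ G.Adj p.1 p.2).card

/-- `Δ^{ir}(z)` (counted over ordered pairs): irregular triangles at `z` in `Ĝ = G ⊔ R`. -/
def numTriIrB (G R : SimpleGraph (Fin N)) (z : Fin N) : ℕ :=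
  (univ.filter fun p : Fin N × Fin N =>
    (G ⊔ R).Adj z p.1 ∧ (G ⊔ R).Adj z p.2 ∧ (G ⊔ R).Adj p.1 p.2 ∧
      ¬exactlyTwoB G z p.1 p.2).card

/-- The number of ordered pairs of neighbors of `x` that are adjacent,
i.e. twice the number of triangles containing `x`. -/
def triOrd {α : Type*} [Fintype α] (H : SimpleGraph α) (x : α) : ℕ :=
  (univ.filter fun p : α × α => H.Adj x p.1 ∧ H.Adj x p.2 ∧ H.Adj p.1 p.2).card

/-- The local clustering coefficient
`C_x = #{edges between neighbors of x} / (deg x choose 2)`. -/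
def clustering {α : Type*} [Fintype α] (H : SimpleGraph α) (x : α) : ℝ :=
  (triOrd H x : ℝ) / ((degH H x : ℝ) * ((degH H x : ℝ) - 1))

/-- The degree of vertex `i` in the random graph `Gₙʳ` built from the digit variables `D`
(neighbors `j ≠ i` are counted). -/
def degR (G : SimpleGraph (Fin N)) (V1 : Finset (Fin N)) {n M : ℕ} {Ω : Type*}
    (D : Fin M → Fin n → Ω → Fin N) (i : Fin M) (ω : Ω) : ℕ :=
  (univ.filter fun j : Fin M => j ≠ i ∧
    EdgeRel G V1 (fun k => D i k ω) (fun k => D j k ω)).card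

/-- `t_k = (d₁^{k+1} - 1)/(d₁ - 1) + 1`. -/
def tkD (d₁ k : ℕ) : ℝ := ((d₁ : ℝ) ^ (k + 1) - 1) / ((d₁ : ℝ) - 1) + 1

/-- The word `x` changes type between the positions `i` and `i + 1`. -/
def IsBreak (V1 : Finset (Fin N)) {n : ℕ} (x : Fin n → Fin N) (i : Fin n) : Prop :=
  ∃ h : i.val + 1 < n, ¬((x i ∈ V1) ↔ x ⟨i.val + 1, h⟩ ∈ V1)

/-- The positions `i ≥ k` after which the word `x` changes type. -/
def breaks (V1 : Finset (Fin N)) {n : ℕ} (k : ℕ) (x : Fin n → Fin N) : Finset (Fin n) :=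
  univ.filter fun i => k ≤ i.val ∧ IsBreak V1 x i

/-- All letters of `x` from position `k` on have the same type. -/
def ConstFrom (V1 : Finset (Fin N)) {n : ℕ} (k : ℕ) (x : Fin n → Fin N) : Prop :=
  ∀ i j : Fin n, k ≤ i.val → k ≤ j.val → (x i ∈ V1 ↔ x j ∈ V1)

lemma lt_card_filter_iff {n : ℕ} {P : Fin n → Prop} [DecidablePred P]
    (hP : ∀ i j, i ≤ j → P j → P i)
    (i : Fin n) : i.val < (univ.filter P).card ↔ P i := by
  constructor
  · intro h
    by_contra hi
    have : univ.filter P ⊆ Iio i := by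
      intro j hj
      simp only [mem_filter, mem_univ, true_and] at hj
      rw [mem_Iio]
      by_contra hij
      exact hi (hP i j (not_lt.1 hij) hj)
    have := card_le_card this
    rw [Fin.card_Iio] at this
    omega
  · intro h
    have : Iic i ⊆ univ.filter P := by
      intro j hj
      simp only [mem_filter, mem_univ, true_and]
      exact hP j i (mem_Iic.1 hj) h
    have := card_le_card this
    rw [Fin.card_Iic] at this
    omega

lemma lt_prefixLen_iff {n : ℕ} (x y : Fin n → Fin N) (i : Fin n) :
    i.val < prefixLen x y ↔ ∀ j ≤ i, x j = y j :=
  lt_card_filter_iff (P := fun i => ∀ j ≤ i, x j = y j)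
    (fun _ _ hij h k hk => h k (hk.trans hij)) i

lemma EdgeRel.exists_prefix {G : SimpleGraph (Fin N)} {V1 : Finset (Fin N)} {n : ℕ}
    {x y : Fin n → Fin N} (hne : x ≠ y) (h : EdgeRel G V1 x y) :
    ∃ p : ℕ, (∀ j : Fin n, j.val < p → x j = y j) ∧ (∀ j : Fin n, p ≤ j.val → x j ≠ y j) ∧
      ConstFrom V1 p x ∧ ConstFrom V1 p y := by
  obtain h | ⟨⟨t, hx, hy⟩, hadj⟩ := h
  · exact absurd h hne
  · exact ⟨prefixLen x y, fun j hj => (lt_prefixLen_iff x y j).1 hj j le_rfl,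
      fun j hj => (hadj j hj).ne,
      fun i j hi hj => (hx i hi).trans (hx j hj).symm,
      fun i j hi hj => (hy i hi).trans (hy j hj).symm⟩

lemma GnSimple.exists_prefix {G : SimpleGraph (Fin N)} {V1 : Finset (Fin N)} {n : ℕ}
    {x y : Fin n → Fin N} (h : (GnSimple G V1 n).Adj x y) :
    ∃ p : ℕ, (∀ j : Fin n, j.val < p → x j = y j) ∧ (∀ j : Fin n, p ≤ j.val → x j ≠ y j) ∧
      ConstFrom V1 p x ∧ ConstFrom V1 p y := by
  obtain ⟨hne, h | h⟩ := h
  · exact h.exists_prefix hne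
  · obtain ⟨p, h1, h2, h3, h4⟩ := h.exists_prefix hne.symm
    exact ⟨p, fun j hj => (h1 j hj).symm, fun j hj => (h2 j hj).symm, h4, h3⟩

lemma GnSimple.adj_of_forall_adj {G : SimpleGraph (Fin N)} {V1 : Finset (Fin N)}
    (hbip : ∀ a b : Fin N, G.Adj a b → (a ∈ V1 ↔ b ∉ V1)) {n : ℕ}
    {x y : Fin n → Fin N} (p : Fin n) (heq : ∀ j < p, x j = y j)
    (hadj : ∀ j, p ≤ j → G.Adj (x j) (y j)) (hx : ConstFrom V1 p x) :
    (GnSimple G V1 n).Adj x y := by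
  refine ⟨fun h => (hadj p le_rfl).ne (congrFun h p), Or.inl (Or.inr ?_)⟩
  have key : ∀ i : Fin n, prefixLen x y ≤ i.val → p ≤ i := by
    intro i hi
    by_contra hlt
    have := (lt_prefixLen_iff x y i).2 fun j hj => heq j (lt_of_le_of_lt hj (not_le.1 hlt))
    omega
  refine ⟨⟨decide (x p ∈ V1), fun i hi => ?_, fun i hi => ?_⟩, fun i hi => hadj i (key i hi)⟩
  · rw [hx i p (key i hi) le_rfl]
    simp
  · have h1 := hx i p (key i hi) le_rfl
    have h2 := hbip _ _ (hadj i (key i hi))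
    simp only [Bool.not_eq_true', decide_eq_false_iff_not]
    tauto

lemma breaks_eq_empty_of_constFrom {V1 : Finset (Fin N)} {n k : ℕ} {x : Fin n → Fin N}
    (h : ConstFrom V1 k x) : breaks V1 k x = ∅ := by
  refine filter_eq_empty_iff.2 ?_
  rintro i - ⟨hk, hi, hb⟩
  exact hb (h _ _ hk (by simp; omega))

lemma constFrom_of_forall_not_isBreak {V1 : Finset (Fin N)} {n k : ℕ} {x : Fin n → Fin N}
    (h : ∀ i : Fin n, k ≤ i.val → ¬IsBreak V1 x i) : ConstFrom V1 k x := by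
  have key : ∀ d : ℕ, ∀ i j : Fin n, k ≤ i.val → j.val = i.val + d →
      (x i ∈ V1 ↔ x j ∈ V1) := by
    intro d
    induction d with
    | zero =>
      intro i j _ hj
      rw [Fin.ext (hj : j.val = i.val)]
    | succ d ih =>
      intro i j hi hj
      have hj' := j.isLt
      have h1 := ih i ⟨i.val + d, by omega⟩ hi rfl
      have h2 := h ⟨i.val + d, by omega⟩ (by simp; omega)
      have h3 : j = ⟨i.val + d + 1, by omega⟩ := Fin.ext (by simp; omega)
      unfold IsBreak at h2
      push Not at h2
      exact (h1.trans (h2 (by simp; omega))).trans (by simp only [h3])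
  intro i j hi hj
  obtain hij | hij := le_total i.val j.val
  · exact key (j.val - i.val) i j hi (by omega)
  · exact (key (i.val - j.val) j i hj (by omega)).symm

lemma ConstFrom.mono {V1 : Finset (Fin N)} {n k l : ℕ} {x : Fin n → Fin N}
    (h : ConstFrom V1 k x) (hkl : k ≤ l) : ConstFrom V1 l x :=
  fun i j hi hj => h i j (hkl.trans hi) (hkl.trans hj)

lemma card_breaks_le_of_adj {G : SimpleGraph (Fin N)} {V1 : Finset (Fin N)} {n : ℕ} (k : ℕ)
    {x y : Fin n → Fin N} (h : (GnSimple G V1 n).Adj x y) :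
    (breaks V1 k x).card ≤ (breaks V1 k y).card + 1 := by
  obtain ⟨p, heq, -, hx, -⟩ := GnSimple.exists_prefix h
  have hlt : ∀ i ∈ breaks V1 k x, i.val < p := by
    intro i hi
    obtain ⟨-, -, hi', hb⟩ := mem_filter.1 hi
    by_contra hp
    exact hb (hx _ _ (not_lt.1 hp) (by simp; omega))
  have hsub : ∀ i ∈ breaks V1 k x, i.val + 1 ≠ p → i ∈ breaks V1 k y := by
    intro i hi hip
    have := hlt i hi
    obtain ⟨-, hk, hi', hb⟩ := mem_filter.1 hi
    refine mem_filter.2 ⟨mem_univ _, hk, hi', ?_⟩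
    rwa [← heq i this, ← heq ⟨i.val + 1, hi'⟩ (by simp; omega)]
  by_cases hex : ∃ i ∈ breaks V1 k x, i.val + 1 = p
  · obtain ⟨i, -, hip⟩ := hex
    refine (card_le_card ?_).trans (card_insert_le i _)
    intro j hj
    by_cases hjp : j.val + 1 = p
    · exact mem_insert.2 (Or.inl (Fin.ext (by omega)))
    · exact mem_insert_of_mem (hsub j hj hjp)
  · push Not at hex
    exact (card_le_card fun j hj => hsub j hj (hex j hj)).trans (Nat.le_succ _)

lemma card_breaks_le_add_length {G : SimpleGraph (Fin N)} {V1 : Finset (Fin N)} {n : ℕ} (k : ℕ)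
    {x y : Fin n → Fin N} (w : (GnSimple G V1 n).Walk x y) :
    (breaks V1 k y).card ≤ (breaks V1 k x).card + w.length := by
  induction w with
  | nil => simp
  | cons h w ih =>
    have := card_breaks_le_of_adj k h.symm
    rw [SimpleGraph.Walk.length_cons]
    omega

lemma breaks_eq_empty_of_adj {G : SimpleGraph (Fin N)} {V1 : Finset (Fin N)} {n : ℕ} {k : Fin n}
    {x y : Fin n → Fin N} (h : (GnSimple G V1 n).Adj x y) (hk : x k ≠ y k) :
    breaks V1 k x = ∅ := by
  obtain ⟨p, heq, -, hx, -⟩ := GnSimple.exists_prefix h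
  have hpk : p ≤ k := by
    by_contra hlt
    exact hk (heq k (not_le.1 hlt))
  exact breaks_eq_empty_of_constFrom (hx.mono hpk)

lemma card_breaks_add_le_length {G : SimpleGraph (Fin N)} {V1 : Finset (Fin N)} {n : ℕ}
    (k : Fin n) {x y : Fin n → Fin N} (w : (GnSimple G V1 n).Walk x y) (hk : x k ≠ y k) :
    (breaks V1 k x).card + (breaks V1 k y).card + 1 ≤ w.length := by
  induction w with
  | nil => exact absurd rfl hk
  | @cons x z y h w ih =>
    rw [SimpleGraph.Walk.length_cons]
    by_cases hz : z k = y k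
    · have hxz : x k ≠ z k := hz ▸ hk
      have h1 := breaks_eq_empty_of_adj h hxz
      have h2 := breaks_eq_empty_of_adj h.symm hxz.symm
      have h3 := card_breaks_le_add_length k w
      rw [h2, card_empty] at h3
      rw [h1, card_empty]
      omega
    · have h1 := card_breaks_le_of_adj k h
      have h2 := ih hz
      omega

lemma exists_walk_constFrom {G : SimpleGraph (Fin N)} {V1 : Finset (Fin N)}
    (hbip : ∀ a b : Fin N, G.Adj a b → (a ∈ V1 ↔ b ∉ V1)) (hnb : ∀ a, ∃ b, G.Adj a b) {n : ℕ}
    (x : Fin n → Fin N) : ∃ (y : Fin n → Fin N) (w : (GnSimple G V1 n).Walk x y),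
      ConstFrom V1 0 y ∧ w.length ≤ (breaks V1 0 x).card := by
  induction hm : (breaks V1 0 x).card generalizing x with
  | zero =>
    refine ⟨x, .nil, constFrom_of_forall_not_isBreak fun i hi hb => ?_, by simp⟩
    rw [card_eq_zero] at hm
    exact (eq_empty_iff_forall_notMem.1 hm) i (mem_filter.2 ⟨mem_univ i, hi, hb⟩)
  | succ m ih =>
    choose f hf using hnb
    have hne : (breaks V1 0 x).Nonempty := by
      rw [← card_pos]
      omega
    obtain ⟨i, hi, hmax⟩ := exists_max_image _ id hne
    obtain ⟨-, -, hi', hb⟩ := mem_filter.1 hi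
    have hconst : ConstFrom V1 (i.val + 1) x := by
      refine constFrom_of_forall_not_isBreak fun j hj hjb => ?_
      have : j.val ≤ i.val := hmax j (mem_filter.2 ⟨mem_univ j, Nat.zero_le _, hjb⟩)
      omega
    have hflip : ∀ a, f a ∈ V1 ↔ a ∉ V1 := by
      intro a
      have := hbip _ _ (hf a)
      tauto
    set z : Fin n → Fin N := fun j => if j ≤ i then x j else f (x j) with hz
    have hadj : (GnSimple G V1 n).Adj x z := by
      refine GnSimple.adj_of_forall_adj hbip ⟨i.val + 1, hi'⟩ (fun j hj => ?_) (fun j hj => ?_)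
        hconst
      · have hji : j ≤ i := Nat.lt_succ_iff.1 hj
        simp [hz, hji]
      · have hji : ¬j ≤ i := by
          intro hle
          exact absurd (lt_of_lt_of_le (Nat.lt_succ_self i.val) hj) (not_lt.2 hle)
        simpa [hz, hji] using hf (x j)
    have hbz : breaks V1 0 z = (breaks V1 0 x).erase i := by
      ext j
      simp only [breaks, IsBreak, mem_erase, mem_filter, mem_univ, true_and, Nat.zero_le]
      obtain hji | hji | hji := lt_trichotomy j i
      · have h1 : j ≤ i := hji.le
        have h2 : ∀ h : j.val + 1 < n, (⟨j.val + 1, h⟩ : Fin n) ≤ i := fun h => hji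
        simp [hz, h1, h2, hji.ne]
      · subst hji
        have h2 : ∀ h : j.val + 1 < n, ¬(⟨j.val + 1, h⟩ : Fin n) ≤ j := by
          intro h hle
          exact absurd (show j.val + 1 ≤ j.val from hle) (by omega)
        simp only [hz, le_rfl, if_true, h2, if_false, hflip, ne_eq, not_true_eq_false, false_and,
          iff_false]
        rintro ⟨h, h'⟩
        tauto
      · have h1 : ¬j ≤ i := not_le.2 hji
        have h2 : ∀ h : j.val + 1 < n, ¬(⟨j.val + 1, h⟩ : Fin n) ≤ i := by
          intro h hle
          have h3 : j.val + 1 ≤ i.val := hle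
          have h4 : i.val < j.val := hji
          omega
        simp [hz, h1, h2, hflip, hji.ne', not_iff_not]
    have hcard : (breaks V1 0 z).card = m := by
      rw [hbz, card_erase_of_mem hi, hm]
      rfl
    obtain ⟨y, w, hy, hw⟩ := ih z hcard
    exact ⟨y, .cons hadj w, hy, by rw [SimpleGraph.Walk.length_cons]; omega⟩

lemma even_length_iff {G : SimpleGraph (Fin N)} {V1 : Finset (Fin N)}
    (hbip : ∀ a b : Fin N, G.Adj a b → (a ∈ V1 ↔ b ∉ V1)) {a b : Fin N} (w : G.Walk a b) :
    Even w.length ↔ (a ∈ V1 ↔ b ∈ V1) := by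
  induction w with
  | nil => simp
  | cons h w ih =>
    have := hbip _ _ h
    rw [SimpleGraph.Walk.length_cons, Nat.even_add_one, ih]
    tauto

lemma exists_walk_length_add_two_mul {G : SimpleGraph (Fin N)} {a b c : Fin N} (hc : G.Adj a c)
    (w : G.Walk a b) (d : ℕ) : ∃ w' : G.Walk a b, w'.length = w.length + 2 * d := by
  induction d with
  | zero => exact ⟨w, rfl⟩
  | succ d ih =>
    obtain ⟨w', hw'⟩ := ih
    refine ⟨.cons hc (.cons hc.symm w'), ?_⟩
    simp only [SimpleGraph.Walk.length_cons]
    omega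

lemma exists_adj_walk_of_length_eq_succ {α : Type*} {G : SimpleGraph α} {a b : α} {m : ℕ}
    (w : G.Walk a b) (hw : w.length = m + 1) :
    ∃ c, G.Adj a c ∧ ∃ w' : G.Walk c b, w'.length = m := by
  cases w with
  | nil => simp at hw
  | cons h w => exact ⟨_, h, w, by simpa using hw⟩

lemma exists_walk_of_forall_walk {G : SimpleGraph (Fin N)} {V1 : Finset (Fin N)}
    (hbip : ∀ a b : Fin N, G.Adj a b → (a ∈ V1 ↔ b ∉ V1)) {n : ℕ} (hn : 0 < n) (m : ℕ)
    {x y : Fin n → Fin N} (hx : ConstFrom V1 0 x)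
    (h : ∀ i, ∃ w : G.Walk (x i) (y i), w.length = m) :
    ∃ w : (GnSimple G V1 n).Walk x y, w.length = m := by
  induction m generalizing x with
  | zero =>
    have hxy : x = y := by
      funext i
      obtain ⟨w, hw⟩ := h i
      exact SimpleGraph.Walk.eq_of_length_eq_zero hw
    subst hxy
    exact ⟨.nil, rfl⟩
  | succ m ih =>
    have step : ∀ i, ∃ c, G.Adj (x i) c ∧ ∃ w : G.Walk c (y i), w.length = m := by
      intro i
      obtain ⟨w, hw⟩ := h i
      exact exists_adj_walk_of_length_eq_succ w hw
    choose z hxz hz using step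
    have hzc : ConstFrom V1 0 z := by
      intro i j hi hj
      have h1 := hbip _ _ (hxz i)
      have h2 := hbip _ _ (hxz j)
      have h3 := hx i j hi hj
      tauto
    obtain ⟨w, hw⟩ := ih hzc hz
    have hadj : (GnSimple G V1 n).Adj x z :=
      GnSimple.adj_of_forall_adj hbip ⟨0, hn⟩ (fun j hj => absurd hj (Nat.not_lt_zero _))
        (fun j _ => hxz j) hx
    exact ⟨.cons hadj w, by simp [hw]⟩

lemma exists_walk_length_lt {G : SimpleGraph (Fin N)} {V1 : Finset (Fin N)}
    (hbip : ∀ a b : Fin N, G.Adj a b → (a ∈ V1 ↔ b ∉ V1)) (hnb : ∀ a, ∃ b, G.Adj a b)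
    (hconn : G.Connected) {n : ℕ} (hn : 0 < n) {x y : Fin n → Fin N} (hx : ConstFrom V1 0 x)
    (hy : ConstFrom V1 0 y) : ∃ w : (GnSimple G V1 n).Walk x y, w.length < N := by
  have : Nonempty (Fin n) := ⟨⟨0, hn⟩⟩
  obtain ⟨i₀, -, hmax⟩ := exists_max_image (univ : Finset (Fin n))
    (fun i => G.dist (x i) (y i)) univ_nonempty
  obtain ⟨p, hp, hpl⟩ := hconn.exists_path_of_dist (x i₀) (y i₀)
  have hlt : G.dist (x i₀) (y i₀) < N := by
    rw [← hpl]
    simpa using hp.length_lt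
  suffices h : ∃ w : (GnSimple G V1 n).Walk x y, w.length = G.dist (x i₀) (y i₀) by
    obtain ⟨w, hw⟩ := h
    exact ⟨w, hw ▸ hlt⟩
  refine exists_walk_of_forall_walk hbip hn _ hx fun i => ?_
  obtain ⟨w, hw⟩ := hconn.exists_walk_length_eq_dist (x i) (y i)
  have hle := hmax i (mem_univ i)
  have h1 := even_length_iff hbip w
  have h2 := even_length_iff hbip p
  rw [hw] at h1
  rw [hpl] at h2
  have h3 := hx i i₀ (Nat.zero_le _) (Nat.zero_le _)
  have h4 := hy i i₀ (Nat.zero_le _) (Nat.zero_le _)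
  have h5 : Even (G.dist (x i₀) (y i₀) - G.dist (x i) (y i)) := by
    rw [Nat.even_sub hle]
    tauto
  obtain ⟨d, hd⟩ := h5
  obtain ⟨c, hc⟩ := hnb (x i)
  obtain ⟨w', hw'⟩ := exists_walk_length_add_two_mul hc w d
  exact ⟨w', by omega⟩

lemma exists_walk_length_lt_card_breaks {G : SimpleGraph (Fin N)} {V1 : Finset (Fin N)}
    (hbip : ∀ a b : Fin N, G.Adj a b → (a ∈ V1 ↔ b ∉ V1)) (hnb : ∀ a, ∃ b, G.Adj a b)
    (hconn : G.Connected) {n : ℕ} (hn : 0 < n) (x y : Fin n → Fin N) :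
    ∃ w : (GnSimple G V1 n).Walk x y,
      w.length < (breaks V1 0 x).card + (breaks V1 0 y).card + N := by
  obtain ⟨x', w₁, hx, hw₁⟩ := exists_walk_constFrom hbip hnb x
  obtain ⟨y', w₂, hy, hw₂⟩ := exists_walk_constFrom hbip hnb y
  obtain ⟨w₃, hw₃⟩ := exists_walk_length_lt hbip hnb hconn hn hx hy
  refine ⟨w₁.append (w₃.append w₂.reverse), ?_⟩
  simp only [SimpleGraph.Walk.length_append, SimpleGraph.Walk.length_reverse]
  omega

/-- The indicator that the word `x` changes type after position `i`. -/
def breakInd (V1 : Finset (Fin N)) {n : ℕ} (x : Fin n → Fin N) (i : Fin n) : ℝ :=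
  if IsBreak V1 x i then 1 else 0

/-- The indicator that `x` and `y` agree up to position `i`. -/
def agreeInd {n : ℕ} (x y : Fin n → Fin N) (i : Fin n) : ℝ :=
  if ∀ j ≤ i, x j = y j then 1 else 0

lemma card_breaks_zero (V1 : Finset (Fin N)) {n : ℕ} (x : Fin n → Fin N) :
    ((breaks V1 0 x).card : ℝ) = ∑ i, breakInd V1 x i := by
  simp [breaks, breakInd]

lemma card_breaks_eq_sum (V1 : Finset (Fin N)) {n : ℕ} (k : Fin n) (x y z : Fin n → Fin N)
    (hlt : ∀ j < k, x j = y j) (hk : x k ≠ y k) :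
    ((breaks V1 k z).card : ℝ) = ∑ i, breakInd V1 z i * (1 - agreeInd x y i) := by
  rw [breaks, card_filter]
  push_cast
  refine sum_congr rfl fun i _ => ?_
  unfold breakInd agreeInd
  have : (∀ j ≤ i, x j = y j) ↔ ¬k.val ≤ i.val := by
    constructor
    · exact fun h hki => hk (h k hki)
    · exact fun h j hj => hlt j (lt_of_le_of_lt hj (not_le.1 h))
  rw [if_congr this rfl rfl]
  by_cases h1 : k.val ≤ i.val <;> by_cases h2 : IsBreak V1 z i <;> simp [h1, h2]

lemma card_filter_pair {n : ℕ} (hN : N ≠ 0) (A B : Finset (Fin N)) {i j : Fin n} (hij : i ≠ j) :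
    (((univ : Finset (Fin n → Fin N)).filter fun x => x i ∈ A ∧ x j ∈ B).card : ℝ)
      = A.card / N * (B.card / N) * (N : ℝ) ^ n := by
  have hN' : (N : ℝ) ≠ 0 := Nat.cast_ne_zero.2 hN
  have : (univ : Finset (Fin n → Fin N)).filter (fun x => x i ∈ A ∧ x j ∈ B)
      = Fintype.piFinset fun l => if l = i then A else if l = j then B else univ := by
    ext x
    simp only [mem_filter, mem_univ, true_and, Fintype.mem_piFinset]
    constructor
    · rintro ⟨h1, h2⟩ l
      split_ifs with h h'
      · exact h ▸ h1
      · exact h' ▸ h2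
      · exact mem_univ _
    · intro h
      have h1 := h i
      have h2 := h j
      rw [if_pos rfl] at h1
      rw [if_neg hij.symm, if_pos rfl] at h2
      exact ⟨h1, h2⟩
  rw [this, Fintype.card_piFinset]
  push_cast
  have h : ∀ l : Fin n, (((if l = i then A else if l = j then B else univ).card : ℕ) : ℝ)
      = (if l = i then (A.card : ℝ) / N else 1) * (if l = j then (B.card : ℝ) / N else 1) * N := by
    intro l
    split_ifs with h1 h2 h2
    · exact absurd (h1.symm.trans h2) hij
    · field_simp
    · field_simp
    · simp
  rw [prod_congr rfl fun l _ => h l, prod_mul_distrib, prod_mul_distrib]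
  simp

lemma sum_breakInd (hN : N ≠ 0) (V1 : Finset (Fin N)) {n : ℕ} (i : Fin n) :
    ∑ x : Fin n → Fin N, breakInd V1 x i = if i.val + 1 < n then
      2 * (V1.card / N * (V1ᶜ.card / N) * (N : ℝ) ^ n) else 0 := by
  split_ifs with h
  · have hne : i ≠ ⟨i.val + 1, h⟩ := fun h' => absurd (congrArg Fin.val h') (by simp)
    have e : ∀ x : Fin n → Fin N, breakInd V1 x i
        = (if x i ∈ V1 ∧ x ⟨i.val + 1, h⟩ ∈ V1ᶜ then (1 : ℝ) else 0)
          + (if x i ∈ V1ᶜ ∧ x ⟨i.val + 1, h⟩ ∈ V1 then (1 : ℝ) else 0) := by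
      intro x
      unfold breakInd IsBreak
      by_cases h1 : x i ∈ V1 <;> by_cases h2 : x ⟨i.val + 1, h⟩ ∈ V1 <;> simp [h1, h2, h]
    rw [sum_congr rfl fun x _ => e x, sum_add_distrib, sum_boole, sum_boole,
      card_filter_pair hN _ _ hne, card_filter_pair hN _ _ hne]
    ring
  · exact sum_eq_zero fun x _ => if_neg fun hb => h hb.1

lemma sum_agreeInd {n : ℕ} (x : Fin n → Fin N) (i : Fin n) :
    ∑ y : Fin n → Fin N, agreeInd x y i = (N : ℝ) ^ (n - 1 - i.val) := by
  unfold agreeInd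
  rw [sum_boole]
  have : (univ : Finset (Fin n → Fin N)).filter (fun y => ∀ j ≤ i, x j = y j)
      = Fintype.piFinset fun l => if l ≤ i then {x l} else univ := by
    ext y
    simp only [mem_filter, mem_univ, true_and, Fintype.mem_piFinset]
    refine forall_congr' fun l => ?_
    by_cases hl : l ≤ i <;> simp [hl, eq_comm]
  rw [this, Fintype.card_piFinset]
  have h : ∀ l : Fin n, (if l ≤ i then {x l} else (univ : Finset (Fin N))).card
      = if l ∈ Ioi i then N else 1 := by
    intro l
    by_cases hl : l ≤ i
    · simp [hl]
    · simp [hl, not_le.1 hl]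
  rw [prod_congr rfl fun l _ => h l, prod_ite_mem]
  simp

lemma agreeInd_comm {n : ℕ} (x y : Fin n → Fin N) (i : Fin n) :
    agreeInd x y i = agreeInd y x i := by
  simp only [agreeInd, eq_comm]

lemma sum_breakInd_mul_agreeInd_lt (hN : 2 ≤ N) (V1 : Finset (Fin N)) {n : ℕ} (hn : 0 < n) :
    2 * ∑ i : Fin n, ∑ x : Fin n → Fin N, breakInd V1 x i * (N : ℝ) ^ (n - 1 - i.val)
      < (N : ℝ) ^ n * ((N : ℝ) ^ n - 1) := by
  have hN0 : (0 : ℝ) < N := by positivity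
  have hpow : (0 : ℝ) < (N : ℝ) ^ n := by positivity
  have hc : (V1.card : ℝ) + V1ᶜ.card = N := by
    have := card_add_card_compl V1
    rw [Fintype.card_fin] at this
    exact_mod_cast this
  have hq : 4 * ((V1.card : ℝ) / N * (V1ᶜ.card / N)) ≤ 1 := by
    have : (V1.card : ℝ) / N * (V1ᶜ.card / N) = V1.card * V1ᶜ.card / (N : ℝ) ^ 2 := by
      field_simp
    rw [this, mul_div_assoc', div_le_one (by positivity), ← hc]
    nlinarith [sq_nonneg ((V1.card : ℝ) - V1ᶜ.card)]
  have hle : ∀ i : Fin n, 2 * ∑ x : Fin n → Fin N, breakInd V1 x i * (N : ℝ) ^ (n - 1 - i.val)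
      ≤ (N : ℝ) ^ n * ((N : ℝ) ^ (n - 1 - i.val) - if i.val = n - 1 then 1 else 0) := by
    intro i
    rw [← sum_mul, sum_breakInd (by omega)]
    have hi := i.isLt
    split_ifs with h1 h2 h2
    · omega
    · have : (0 : ℝ) < (N : ℝ) ^ (n - 1 - i.val) := by positivity
      nlinarith [mul_pos hpow this]
    · simp [h2]
    · omega
  have hgeom : ∑ i ∈ range n, (N : ℝ) ^ i < (N : ℝ) ^ n := by
    have : ∑ i ∈ range n, N ^ i < N ^ n := Nat.geomSum_lt hN (fun k hk => mem_range.1 hk)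
    exact_mod_cast this
  rw [mul_sum]
  refine (sum_le_sum fun i _ => hle i).trans_lt ?_
  rw [← mul_sum, sum_sub_distrib]
  refine mul_lt_mul_of_pos_left ?_ hpow
  rw [Fin.sum_univ_eq_sum_range fun i => (N : ℝ) ^ (n - 1 - i),
    Fin.sum_univ_eq_sum_range fun i => if i = n - 1 then (1 : ℝ) else 0,
    sum_range_reflect (fun i => (N : ℝ) ^ i), sum_ite_eq', if_pos (mem_range.2 (by omega))]
  linarith

lemma sum_sum_breakInd (hN : N ≠ 0) (V1 : Finset (Fin N)) {n : ℕ} (hn : 0 < n) :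
    ∑ x : Fin n → Fin N, ∑ i, breakInd V1 x i
      = 2 * (V1.card / N * (V1ᶜ.card / N) * (N : ℝ) ^ n) * ((n : ℝ) - 1) := by
  rw [sum_comm, sum_congr rfl fun i _ => sum_breakInd hN V1 i,
    Fin.sum_univ_eq_sum_range fun i => if i + 1 < n then
      2 * (V1.card / N * (V1ᶜ.card / N) * (N : ℝ) ^ n) else 0]
  obtain ⟨m, rfl⟩ := Nat.exists_eq_succ_of_ne_zero hn.ne'
  rw [sum_range_succ, if_neg (lt_irrefl _),
    sum_congr rfl fun i hi => if_pos (Nat.succ_lt_succ (mem_range.1 hi))]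
  simp
  ring

lemma le_dist {G : SimpleGraph (Fin N)} {V1 : Finset (Fin N)} {n : ℕ}
    (hconn : (GnSimple G V1 n).Connected) (x y : Fin n → Fin N) :
    ∑ i, breakInd V1 x i * (1 - agreeInd x y i) + ∑ i, breakInd V1 y i * (1 - agreeInd x y i)
      + (1 - if x = y then 1 else 0) ≤ ((GnSimple G V1 n).dist x y : ℝ) := by
  by_cases hxy : x = y
  · subst hxy
    simp [agreeInd]
  · have hne : (univ.filter fun i => x i ≠ y i).Nonempty := by
      obtain ⟨i, hi⟩ := Function.ne_iff.1 hxy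
      exact ⟨i, by simpa using hi⟩
    obtain ⟨k, hk, hmin⟩ := exists_min_image _ id hne
    simp only [mem_filter, mem_univ, true_and, id] at hk hmin
    have hlt : ∀ j < k, x j = y j := by
      intro j hj
      by_contra h
      exact absurd (hmin j h) (not_le.2 hj)
    obtain ⟨w, hw⟩ := hconn.exists_walk_length_eq_dist x y
    have := card_breaks_add_le_length k w hk
    rw [← card_breaks_eq_sum V1 k x y x hlt hk, ← card_breaks_eq_sum V1 k x y y hlt hk, if_neg hxy,
      ← hw]
    simp only [sub_zero]
    exact_mod_cast this

/-- the expected distance of two uniform random vertices of `Gₙ` satisfies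
`(4n₁n₂/N²)(n-1) < E[dist(X,Y)] < N + (4n₁n₂/N²)(n-1)`. -/
theorem statement11 {N : ℕ} (G : SimpleGraph (Fin N)) (V1 : Finset (Fin N))
    (hV1 : V1.Nonempty) (hV2 : V1ᶜ.Nonempty)
    (hbip : ∀ a b : Fin N, G.Adj a b → (a ∈ V1 ↔ b ∉ V1))
    (hE : G.edgeFinset.Nonempty) (hconn : G.Connected)
    {n : ℕ} (hn : 0 < n) :
    4 * (V1.card : ℝ) * (V1ᶜ.card : ℝ) / (N : ℝ) ^ 2 * ((n : ℝ) - 1)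
        < (∑ x : Fin n → Fin N, ∑ y : Fin n → Fin N, ((GnSimple G V1 n).dist x y : ℝ))
            / (N : ℝ) ^ (2 * n) ∧
      (∑ x : Fin n → Fin N, ∑ y : Fin n → Fin N, ((GnSimple G V1 n).dist x y : ℝ))
            / (N : ℝ) ^ (2 * n)
        < (N : ℝ) + 4 * (V1.card : ℝ) * (V1ᶜ.card : ℝ) / (N : ℝ) ^ 2 * ((n : ℝ) - 1)
    := by
  obtain ⟨a, ha⟩ := hV1
  obtain ⟨b, hb⟩ := hV2
  have hab : a ≠ b := by
    rintro rfl
    exact (mem_compl.1 hb) ha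
  have hN : 2 ≤ N := by
    have h1 := a.isLt
    have h2 := b.isLt
    have h3 : a.val ≠ b.val := fun h => hab (Fin.ext h)
    omega
  have : Nontrivial (Fin N) := ⟨a, b, hab⟩
  have : Nonempty (Fin n → Fin N) := ⟨fun _ => a⟩
  have hnb : ∀ c, ∃ d, G.Adj c d := fun c => hconn.preconnected.exists_adj_of_nontrivial c
  have hGn : (GnSimple G V1 n).Connected :=
    ⟨fun x y => (exists_walk_length_lt_card_breaks hbip hnb hconn hn x y).choose.reachable⟩
  have hN0 : (0 : ℝ) < N := by positivity
  have hT : (0 : ℝ) < (N : ℝ) ^ n := by positivity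
  have hcard : ((univ : Finset (Fin n → Fin N)).card : ℝ) = (N : ℝ) ^ n := by simp
  have hA := sum_sum_breakInd (by omega : N ≠ 0) V1 hn
  have hL := sum_breakInd_mul_agreeInd_lt hN V1 hn
  have hq : 4 * (V1.card : ℝ) * (V1ᶜ.card : ℝ) / (N : ℝ) ^ 2
      = 4 * ((V1.card : ℝ) / N * (V1ᶜ.card / N)) := by
    field_simp
  rw [hq, show 2 * n = n + n by ring, pow_add]
  generalize (V1.card : ℝ) / N * (V1ᶜ.card / N) = q at *
  have hsx : ∑ x : Fin n → Fin N, ∑ _y : Fin n → Fin N, ∑ i, breakInd V1 x i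
      = (N : ℝ) ^ n * (2 * (q * (N : ℝ) ^ n) * ((n : ℝ) - 1)) := by
    simp only [sum_const, nsmul_eq_mul, hcard]
    rw [← mul_sum, hA]
  have hsy : ∑ _x : Fin n → Fin N, ∑ y : Fin n → Fin N, ∑ i, breakInd V1 y i
      = (N : ℝ) ^ n * (2 * (q * (N : ℝ) ^ n) * ((n : ℝ) - 1)) := by
    rw [sum_const, nsmul_eq_mul, hcard, hA]
  have hax : ∑ x : Fin n → Fin N, ∑ y : Fin n → Fin N, ∑ i, breakInd V1 x i * agreeInd x y i
      = ∑ i : Fin n, ∑ x : Fin n → Fin N, breakInd V1 x i * (N : ℝ) ^ (n - 1 - i.val) := by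
    rw [sum_comm (s := (univ : Finset (Fin n)))]
    refine sum_congr rfl fun x _ => ?_
    rw [sum_comm]
    exact sum_congr rfl fun i _ => by rw [← mul_sum, sum_agreeInd]
  have hay : ∑ x : Fin n → Fin N, ∑ y : Fin n → Fin N, ∑ i, breakInd V1 y i * agreeInd x y i
      = ∑ i : Fin n, ∑ x : Fin n → Fin N, breakInd V1 x i * (N : ℝ) ^ (n - 1 - i.val) := by
    rw [sum_comm, ← hax]
    exact sum_congr rfl fun x _ => sum_congr rfl fun y _ => sum_congr rfl fun i _ => by
      rw [agreeInd_comm]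
  constructor
  · rw [lt_div_iff₀ (mul_pos hT hT)]
    refine lt_of_lt_of_le ?_ (sum_le_sum fun x _ => sum_le_sum fun y _ => le_dist hGn x y)
    simp only [mul_sub, mul_one, sum_sub_distrib, sum_add_distrib, hsx, hsy, hax, hay]
    simp only [sum_const, nsmul_eq_mul, hcard, sum_ite_eq, mem_univ, if_true, mul_one]
    linarith
  · rw [div_lt_iff₀ (mul_pos hT hT)]
    have hU : ∀ x y : Fin n → Fin N, ((GnSimple G V1 n).dist x y : ℝ)
        < ∑ i, breakInd V1 x i + ∑ i, breakInd V1 y i + N := by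
      intro x y
      obtain ⟨w, hw⟩ := exists_walk_length_lt_card_breaks hbip hnb hconn hn x y
      rw [← card_breaks_zero, ← card_breaks_zero]
      exact_mod_cast (SimpleGraph.dist_le w).trans_lt hw
    refine lt_of_lt_of_le (sum_lt_sum_of_nonempty univ_nonempty fun x _ =>
      sum_lt_sum_of_nonempty univ_nonempty fun y _ => hU x y) ?_
    simp only [sum_add_distrib, hsx, hsy]
    simp only [sum_const, nsmul_eq_mul, hcard]
    linarith

end HierGraph
end
end

section
/- For every n ≥ 1 and every x = (x₁…x_n) ∈ Σ_n, the degree of x in Ĝ_n equals deĝ_n(x) = S(x)·deg(x_n) + (deĝ(x_n) − deg(x_n)), where S(x) = Σ_{r=0}^{ℓ(x)−1} Π_{j=1}^{r} deg(x_{n−j}), deĝ denotes degree in Ĝ and deg denotes degree in G. -/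
noncomputable section
attribute [local instance] Classical.propDecidable

namespace HierGraph

open Finset MeasureTheory ProbabilityTheory

variable {N : ℕ}

lemma prefixLen_comm {n : ℕ} (x y : Fin n → Fin N) : prefixLen x y = prefixLen y x := by
  simp only [prefixLen, eq_comm]

/-- The first disagreement of two words sits at position `prefixLen`. -/
lemma prefixLen_eq_of_first_ne {n : ℕ} {x y : Fin n → Fin N} {k : Fin n}
    (hlt : ∀ i < k, x i = y i) (hne : x k ≠ y k) : prefixLen x y = k := by
  have hfilter : (univ.filter fun i : Fin n => ∀ j : Fin n, j ≤ i → x j = y j) = Iio k := by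
    ext i
    simp only [mem_filter, mem_univ, true_and, mem_Iio]
    exact ⟨fun h => lt_of_not_ge fun hki => hne (h k hki),
      fun h j hj => hlt j (hj.trans_lt h)⟩
  rw [prefixLen, hfilter, Fin.card_Iio]

lemma exists_first_ne {n : ℕ} {x y : Fin n → Fin N} (h : x ≠ y) :
    ∃ k : Fin n, (∀ i < k, x i = y i) ∧ x k ≠ y k := by
  obtain ⟨k, hk, hmin⟩ := WellFounded.has_min (wellFounded_lt (α := Fin n))
    {i | x i ≠ y i} (Function.ne_iff.mp h)
  exact ⟨k, fun i hi => by_contra fun hne => hmin i hne hi, hk⟩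

lemma GnEdge'.symm {G : SimpleGraph (Fin N)} {V1 : Finset (Fin N)} {n : ℕ}
    {x y : Fin n → Fin N} (h : GnEdge' G V1 x y) : GnEdge' G V1 y x := by
  obtain ⟨hne, heq | ⟨⟨t, hx, hy⟩, hadj⟩⟩ := h
  · exact absurd heq hne
  · rw [prefixLen_comm] at hx hy hadj
    exact ⟨hne.symm, Or.inr ⟨⟨!t, hy, by simpa using hx⟩, fun i hi => (hadj i hi).symm⟩⟩

lemma REn.symm {R : SimpleGraph (Fin N)} {n : ℕ} {x y : Fin n → Fin N} (h : REn R x y) :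
    REn R y x := by
  obtain ⟨hn, heq, hadj⟩ := h
  exact ⟨hn, fun i hi => (heq i hi).symm, hadj.symm⟩

lemma REn.ne {R : SimpleGraph (Fin N)} {n : ℕ} {x y : Fin n → Fin N} (h : REn R x y) :
    x ≠ y := by
  rintro rfl
  obtain ⟨_, _, hadj⟩ := h
  exact hadj.ne rfl

lemma hatGn_adj_iff {G R : SimpleGraph (Fin N)} {V1 : Finset (Fin N)} {n : ℕ}
    {x y : Fin n → Fin N} :
    (HatGn G R V1 n).Adj x y ↔ GnEdge' G V1 x y ∨ REn R x y := by
  rw [HatGn, SimpleGraph.fromRel_adj]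
  constructor
  · rintro ⟨_, h | h | h⟩
    · exact h
    · exact Or.inl h.symm
    · exact Or.inr h.symm
  · intro h
    exact ⟨h.elim (fun h => h.1) REn.ne, Or.inl h⟩

lemma gnEdge'_iff {G : SimpleGraph (Fin N)} {V1 : Finset (Fin N)}
    (hbip : ∀ a b : Fin N, G.Adj a b → (a ∈ V1 ↔ b ∉ V1)) {n : ℕ} {x y : Fin n → Fin N} :
    GnEdge' G V1 x y ↔ ∃ k : Fin n, (∃ t, postfixType V1 k x t) ∧
      (∀ i < k, x i = y i) ∧ ∀ i, k ≤ i → G.Adj (x i) (y i) := by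
  constructor
  · rintro ⟨hne, heq | ⟨⟨t, hx, -⟩, hadj⟩⟩
    · exact absurd heq hne
    · obtain ⟨k, hlt, hk⟩ := exists_first_ne hne
      rw [prefixLen_eq_of_first_ne hlt hk] at hx hadj
      exact ⟨k, ⟨t, hx⟩, hlt, hadj⟩
  · rintro ⟨k, ⟨t, hx⟩, hlt, hadj⟩
    have hk : x k ≠ y k := (hadj k le_rfl).ne
    refine ⟨fun h => hk (congrFun h k), Or.inr ?_⟩
    rw [prefixLen_eq_of_first_ne hlt hk]
    refine ⟨⟨t, hx, fun i hi => ?_⟩, hadj⟩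
    have hxi := hx i hi
    have hb := hbip _ _ (hadj i hi)
    cases t <;> simp_all

lemma lt_ell_iff {V1 : Finset (Fin N)} {n : ℕ} {x : Fin n → Fin N} {r : ℕ} :
    r < ell V1 x ↔ r < n ∧ ∃ t, postfixType V1 (n - 1 - r) x t := by
  rw [ell, Finset.lt_sup_iff]
  simp only [mem_filter, mem_Icc, id, postfixType]
  constructor
  · rintro ⟨i, ⟨⟨_, hin⟩, h | h⟩, hri⟩
    · exact ⟨by omega, true, fun j hj => by simpa using h j (by omega)⟩
    · exact ⟨by omega, false, fun j hj => by simpa using h j (by omega)⟩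
  · rintro ⟨hr, t, h⟩
    refine ⟨r + 1, ⟨⟨by omega, hr⟩, ?_⟩, by omega⟩
    cases t
    · exact Or.inr fun j hj => by simpa using h j (by omega)
    · exact Or.inl fun j hj => by simpa using h j (by omega)

/-- Words agreeing with `x` before its last `r + 1` letters, and whose last `r + 1` letters are
`G`-neighbours of those of `x`. -/
def suffixNbrs (G : SimpleGraph (Fin N)) {n : ℕ} (x : Fin n → Fin N) (r : ℕ) :
    Finset (Fin n → Fin N) :=
  Fintype.piFinset fun i => if n ≤ i.val + r + 1 then univ.filter (G.Adj (x i)) else {x i}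

lemma mem_suffixNbrs {G : SimpleGraph (Fin N)} {n : ℕ} {x y : Fin n → Fin N} {r : ℕ} :
    y ∈ suffixNbrs G x r ↔
      ∀ i : Fin n, if n ≤ i.val + r + 1 then G.Adj (x i) (y i) else x i = y i := by
  rw [suffixNbrs, Fintype.mem_piFinset]
  refine forall_congr' fun i => ?_
  split_ifs <;> simp [eq_comm]

lemma card_suffixNbrs (G : SimpleGraph (Fin N)) {n : ℕ} (hn : 0 < n) (x : Fin n → Fin N)
    {r : ℕ} (hr : r < n) :
    (suffixNbrs G x r).card = (∏ j ∈ Finset.Icc 1 r, degH G (x ⟨n - 1 - j, by omega⟩)) *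
      degH G (x ⟨n - 1, Nat.sub_lt hn Nat.one_pos⟩) := by
  have hcard : ∀ i : Fin n,
      (if n ≤ i.val + r + 1 then univ.filter (G.Adj (x i)) else {x i}).card =
        if n ≤ i.val + r + 1 then degH G (x i) else 1 := by
    intro i
    split_ifs <;> simp [degH]
  have hIcc : Finset.Icc 0 r = insert 0 (Finset.Icc 1 r) := by
    ext j
    simp only [mem_insert, mem_Icc]
    omega
  have hreflect : (∏ i : Fin n with n ≤ i.val + r + 1, degH G (x i)) =
      ∏ j ∈ Finset.Icc 0 r, degH G (x ⟨n - 1 - j, by omega⟩) := by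
    refine Finset.prod_nbij' (fun i => n - 1 - i.val) (fun j => ⟨n - 1 - j, by omega⟩)
      ?_ ?_ ?_ ?_ ?_
    · intro i hi
      simp only [mem_filter, mem_univ, true_and, mem_Icc] at hi ⊢
      omega
    · intro j hj
      simp only [mem_filter, mem_univ, true_and, mem_Icc] at hj ⊢
      omega
    · intro i _
      ext
      simp only
      omega
    · intro j hj
      simp only [mem_Icc] at hj ⊢
      omega
    · intro i _
      congr 2
      ext
      simp only
      omega
  rw [suffixNbrs, Fintype.card_piFinset, Finset.prod_congr rfl fun i _ => hcard i,
    ← Finset.prod_filter, hreflect, hIcc, Finset.prod_insert (by simp), mul_comm]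
  rfl

lemma filter_gnEdge'_eq_biUnion {G : SimpleGraph (Fin N)} {V1 : Finset (Fin N)}
    (hbip : ∀ a b : Fin N, G.Adj a b → (a ∈ V1 ↔ b ∉ V1)) {n : ℕ} (x : Fin n → Fin N) :
    (univ.filter fun y => GnEdge' G V1 x y) =
      (Finset.range (ell V1 x)).biUnion (suffixNbrs G x) := by
  ext y
  simp only [mem_filter, mem_univ, true_and, mem_biUnion, mem_range, lt_ell_iff, mem_suffixNbrs,
    gnEdge'_iff hbip]
  constructor
  · rintro ⟨k, ht, hlt, hadj⟩
    refine ⟨n - 1 - k, ⟨by omega, ?_⟩, fun i => ?_⟩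
    · rwa [show n - 1 - (n - 1 - k.val) = k.val by omega]
    · split_ifs with hi
      · exact hadj i (Fin.le_def.mpr (by omega))
      · exact hlt i (Fin.lt_def.mpr (by omega))
  · rintro ⟨r, ⟨hr, ht⟩, h⟩
    refine ⟨⟨n - 1 - r, by omega⟩, ht, fun i hi => ?_, fun i hi => ?_⟩
    · simpa [show ¬ n ≤ i.val + r + 1 from by rw [Fin.lt_def] at hi; simp only at hi; omega]
        using h i
    · simpa [show n ≤ i.val + r + 1 from by rw [Fin.le_def] at hi; simp only at hi; omega]
        using h i

lemma disjoint_suffixNbrs (G : SimpleGraph (Fin N)) {n : ℕ} (x : Fin n → Fin N) {r s : ℕ}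
    (hrs : r < s) (hs : s < n) : Disjoint (suffixNbrs G x r) (suffixNbrs G x s) := by
  refine Finset.disjoint_left.mpr fun y hr hs' => ?_
  have h₁ := mem_suffixNbrs.mp hr ⟨n - 1 - s, by omega⟩
  have h₂ := mem_suffixNbrs.mp hs' ⟨n - 1 - s, by omega⟩
  rw [if_neg (by simp only; omega)] at h₁
  rw [if_pos (by simp only; omega)] at h₂
  exact h₂.ne h₁

/-- The number of non-loop edges of `Gₙ` at `x`. -/
lemma card_gnEdge' {G : SimpleGraph (Fin N)} {V1 : Finset (Fin N)}
    (hbip : ∀ a b : Fin N, G.Adj a b → (a ∈ V1 ↔ b ∉ V1)) {n : ℕ} (hn : 0 < n)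
    (x : Fin n → Fin N) :
    (univ.filter fun y => GnEdge' G V1 x y).card =
      Sx G V1 hn x * degH G (x ⟨n - 1, Nat.sub_lt hn Nat.one_pos⟩) := by
  have hlt : ∀ r ∈ Finset.range (ell V1 x), r < n := fun r hr =>
    (lt_ell_iff.mp (mem_range.mp hr)).1
  rw [filter_gnEdge'_eq_biUnion hbip, Finset.card_biUnion, Sx, Finset.sum_mul]
  · exact Finset.sum_congr rfl fun r hr => card_suffixNbrs G hn x (hlt r hr)
  · intro r hr s hs hrs
    rcases lt_or_gt_of_ne hrs with h | h
    · exact disjoint_suffixNbrs G x h (hlt s hs)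
    · exact (disjoint_suffixNbrs G x h (hlt r hr)).symm

/-- The number of extra edges of `Ĝₙ` at `x`. -/
lemma card_REn (R : SimpleGraph (Fin N)) {n : ℕ} (hn : 0 < n) (x : Fin n → Fin N) :
    (univ.filter fun y => REn R x y).card = degH R (x ⟨n - 1, Nat.sub_lt hn Nat.one_pos⟩) := by
  set last : Fin n := ⟨n - 1, Nat.sub_lt hn Nat.one_pos⟩ with hlast
  have hne : ∀ i : Fin n, i.val + 1 < n → i ≠ last := by
    rintro i hi rfl
    simp only [hlast] at hi
    omega
  refine Finset.card_nbij' (fun y => y last) (fun a => Function.update x last a) ?_ ?_ ?_ ?_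
  · intro y hy
    obtain ⟨_, _, hadj⟩ := (mem_filter.mp hy).2
    exact mem_filter.mpr ⟨mem_univ _, hadj⟩
  · intro a ha
    refine mem_filter.mpr ⟨mem_univ _, hn, fun i hi => ?_, ?_⟩
    · exact (Function.update_of_ne (hne i hi) a x).symm
    · show R.Adj (x last) (Function.update x last a last)
      rw [Function.update_self]
      exact (mem_filter.mp ha).2
  · intro y hy
    obtain ⟨_, heq, -⟩ := (mem_filter.mp hy).2
    funext i
    by_cases hi : i.val + 1 < n
    · exact (Function.update_of_ne (hne i hi) _ x).trans (heq i hi)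
    · have hi_last : i = last := Fin.ext (by simp only [hlast]; omega)
      rw [hi_last]
      exact Function.update_self ..
  · intro a _
    exact Function.update_self ..

lemma degH_sup {α : Type*} [Fintype α] {G R : SimpleGraph α}
    (hdisj : ∀ a b, G.Adj a b → ¬R.Adj a b) (v : α) :
    degH (G ⊔ R) v = degH G v + degH R v := by
  simp only [degH, SimpleGraph.sup_adj, Finset.filter_or]
  exact Finset.card_union_of_disjoint (Finset.disjoint_filter.mpr fun w _ => hdisj v w)

lemma GnEdge'.not_REn {G R : SimpleGraph (Fin N)} {V1 : Finset (Fin N)}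
    (hbip : ∀ a b : Fin N, G.Adj a b → (a ∈ V1 ↔ b ∉ V1))
    (hdisj : ∀ a b : Fin N, G.Adj a b → ¬R.Adj a b) {n : ℕ} {x y : Fin n → Fin N}
    (h : GnEdge' G V1 x y) : ¬REn R x y := by
  rintro ⟨hn, _, hR⟩
  obtain ⟨k, -, -, hadj⟩ := (gnEdge'_iff hbip).mp h
  exact hdisj _ _ (hadj ⟨n - 1, Nat.sub_lt hn Nat.one_pos⟩ (Fin.le_def.mpr (by simp only; omega))) hR

/-- `deĝₙ(x) = S(x)·deg(xₙ) + (deĝ(xₙ) - deg(xₙ))`. -/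
theorem statement13 {N : ℕ} (G R : SimpleGraph (Fin N)) (V1 : Finset (Fin N))
    (hV1 : V1.Nonempty) (hV2 : V1ᶜ.Nonempty)
    (hbip : ∀ a b : Fin N, G.Adj a b → (a ∈ V1 ↔ b ∉ V1))
    (hdisj : ∀ a b : Fin N, G.Adj a b → ¬R.Adj a b) (hR : PropertyR G R)
    {n : ℕ} (hn : 0 < n) (x : Fin n → Fin N) :
    degH (HatGn G R V1 n) x
      = Sx G V1 hn x * degH G (x ⟨n - 1, by omega⟩) +
        (degH (G ⊔ R) (x ⟨n - 1, by omega⟩) - degH G (x ⟨n - 1, by omega⟩)) := by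
  rw [degH_sup hdisj, Nat.add_sub_cancel_left, ← card_gnEdge' hbip, ← card_REn R hn, degH,
    ← Finset.card_union_of_disjoint
      (Finset.disjoint_filter.mpr fun y _ h => h.not_REn hbip hdisj), ← Finset.filter_or]
  simp only [hatGn_adj_iff]

end HierGraph
end
end
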